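/- Let K be a number field, let f(X) = X^d + a_{d−1}X^{d−1} + ⋯ + a_0 and g(X) = X^e + b_{e−1}X^{e−1} + ⋯ + b_0 be monic polynomials in K[X] with d − e > 1, set h = f/g, and let |·|_v be a non-archimedean absolute value on the algebraic closure of ℚ. Set B_v = max{1, |a_0|_v, …, |a_{d−1}|_v, |b_0|_v, …, |b_{e−1}|_v}. Suppose α is an algebraic number whose orbit elements α_0 = α, α_1 = h(α_0), …, α_k = h(α_{k−1}) are all defined, and suppose |α_k|_v ≤ B_v. Then |α_ℓ|_v ≤ B_v for all 0 ≤ ℓ ≤ k. -/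

import Mathlib

open Polynomial

theorem aux_eval {F : Type*} [Field F] (v : AbsoluteValue F ℝ)
    (hv : ∀ x y : F, v (x + y) ≤ max (v x) (v y)) (n : ℕ) (c : Fin n → F) (B : ℝ) (hB : 1 ≤ B)
    (hc : ∀ i, v (c i) ≤ B) (x : F) (hx : B < v x) :
    v ((X ^ n + ∑ i : Fin n, C (c i) * X ^ (i : ℕ) : F[X]).eval x) = v x ^ n := by
  have h1 : 1 < v x := lt_of_le_of_lt hB hx
  have h0 : 0 < v x := by linarith
  simp only [eval_add, eval_pow, eval_X, eval_finsetSum, eval_mul, eval_C]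
  have hs : v (∑ i : Fin n, c i * x ^ (i : ℕ)) < v x ^ n := by
    refine Finset.sum_induction _ (fun y => v y < v x ^ n) ?_ ?_ ?_
    · intro p q hp hq
      exact lt_of_le_of_lt (hv p q) (max_lt hp hq)
    · simpa using pow_pos h0 n
    · intro i _
      rw [map_mul, map_pow]
      calc v (c i) * v x ^ (i : ℕ) < v x * v x ^ (i : ℕ) :=
            mul_lt_mul_of_pos_right (lt_of_le_of_lt (hc i) hx) (pow_pos h0 _)
        _ = v x ^ ((i : ℕ) + 1) := by ring
        _ ≤ v x ^ n := pow_le_pow_right₀ h1.le i.2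
  set s := ∑ i : Fin n, c i * x ^ (i : ℕ)
  apply le_antisymm
  · refine (hv _ _).trans ?_
    rw [map_pow]
    exact max_le le_rfl hs.le
  · have h := hv (x ^ n + s) (-s)
    rw [add_neg_cancel_right, map_pow, v.map_neg] at h
    rcases le_max_iff.1 h with h | h
    · exact h
    · linarith

/-- Let `K` be a number field (a finite extension of `ℚ` inside the algebraic
closure `ℚ̄`), let `f(X) = X^d + a_{d-1}X^{d-1} + ⋯ + a_0` and
`g(X) = X^e + b_{e-1}X^{e-1} + ⋯ + b_0` be monic polynomials in `K[X]` with `d - e > 1`, set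
`h = f/g`, and let `v` be a non-archimedean absolute value on `ℚ̄`.  Set
`B_v = max {1, |a_0|_v, …, |a_{d-1}|_v, |b_0|_v, …, |b_{e-1}|_v}`.  Suppose `α ∈ ℚ̄` is such
that the orbit elements `α_0 = α, α_1 = h(α_0), …, α_k = h(α_{k-1})` are all defined, and
suppose `|α_k|_v ≤ B_v`.  Then `|α_ℓ|_v ≤ B_v` for all `0 ≤ ℓ ≤ k`. -/
theorem roots_of_unity_orbits_stmt15
    (K : IntermediateField ℚ (AlgebraicClosure ℚ)) [FiniteDimensional ℚ K]
    (d e : ℕ) (hde : e + 1 < d) (a : Fin d → K) (b : Fin e → K)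
    (f g : Polynomial (AlgebraicClosure ℚ))
    (hf : f = X ^ d + ∑ i : Fin d, C ((a i : AlgebraicClosure ℚ)) * X ^ (i : ℕ))
    (hg : g = X ^ e + ∑ j : Fin e, C ((b j : AlgebraicClosure ℚ)) * X ^ (j : ℕ))
    (v : AbsoluteValue (AlgebraicClosure ℚ) ℝ)
    (hv : ∀ x y : AlgebraicClosure ℚ, v (x + y) ≤ max (v x) (v y))
    (Bv : ℝ)
    (hBv : Bv = max 1 (max (⨆ i : Fin d, v ((a i : AlgebraicClosure ℚ)))
        (⨆ j : Fin e, v ((b j : AlgebraicClosure ℚ)))))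
    (α : AlgebraicClosure ℚ) (k : ℕ)
    (orb : ℕ → AlgebraicClosure ℚ)
    (horb : orb = fun n => (fun x => f.eval x / g.eval x)^[n] α)
    (hdef : ∀ ℓ : ℕ, ℓ < k → g.eval (orb ℓ) ≠ 0)
    (hk : v (orb k) ≤ Bv) :
    ∀ ℓ : ℕ, ℓ ≤ k → v (orb ℓ) ≤ Bv := by
  have hB : 1 ≤ Bv := hBv ▸ le_max_left _ _
  have ha : ∀ i, v ((a i : AlgebraicClosure ℚ)) ≤ Bv := fun i => by
    rw [hBv]
    exact ((le_ciSup (f := fun i : Fin d => v ((a i : AlgebraicClosure ℚ)))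
      (Set.finite_range _).bddAbove i).trans (le_max_left _ _)).trans (le_max_right _ _)
  have hb : ∀ i, v ((b i : AlgebraicClosure ℚ)) ≤ Bv := fun i => by
    rw [hBv]
    exact ((le_ciSup (f := fun i : Fin e => v ((b i : AlgebraicClosure ℚ)))
      (Set.finite_range _).bddAbove i).trans (le_max_right _ _)).trans (le_max_right _ _)
  intro ℓ hℓ
  induction hℓ using Nat.decreasingInduction with
  | self => exact hk
  | of_succ n hn ih =>
    by_contra hcon
    have hx : Bv < v (orb n) := not_le.1 hcon
    have hstep : orb (n + 1) = f.eval (orb n) / g.eval (orb n) := by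
      simp only [horb, Function.iterate_succ_apply']
    have h1 : 1 < v (orb n) := lt_of_le_of_lt hB hx
    have hF : v (f.eval (orb n)) = v (orb n) ^ d := by
      rw [hf]; exact aux_eval v hv d _ Bv hB ha _ hx
    have hG : v (g.eval (orb n)) = v (orb n) ^ e := by
      rw [hg]; exact aux_eval v hv e _ Bv hB hb _ hx
    rw [hstep, map_div₀, hF, hG, div_le_iff₀ (by positivity)] at ih
    have h2 : v (orb n) ^ (e + 1) ≤ v (orb n) ^ d := pow_le_pow_right₀ h1.le hde.le
    have h3 : Bv * v (orb n) ^ e < v (orb n) * v (orb n) ^ e :=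
      mul_lt_mul_of_pos_right hx (by positivity)
    rw [pow_succ'] at h2
    linarith
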